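/- Fix integers d ≥ 1, P ≥ 1 and a core tensor W ∈ ℝ^{P×P×P}. There exists r ∈ ℝ^{d×P} with r ≠ 0 such that f(h,r,t) = −f(t,r,h) for all h, t ∈ ℝ^{d×P} if and only if rank(W_(2)ᵀ + S·W_(2)ᵀ) < P. -/

import Mathlib

open scoped BigOperators
open Matrix

/-- The TDB scoring function `f(h,r,t) = Σ_{l,m,n} W_{lmn} Σ_k h_{kl} r_{km} t_{kn}`. -/
noncomputable def score {d P : ℕ} (W : Fin P → Fin P → Fin P → ℝ)
    (h r t : Fin d → Fin P → ℝ) : ℝ :=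
  ∑ l, ∑ m, ∑ n, W l m n * ∑ k, h k l * r k m * t k n

/-- The transposed mode-2 unfolding `W_(2)ᵀ`: the P²×P matrix whose entry in
row (l,n) and column m is `W_{lmn}`. -/
def W2T {P : ℕ} (W : Fin P → Fin P → Fin P → ℝ) :
    Matrix (Fin P × Fin P) (Fin P) ℝ :=
  Matrix.of fun ln m => W ln.1 m ln.2

/-- The swap permutation matrix `S` with `S_{(i,j),(j,i)} = 1` and other entries 0. -/
def swapMat (P : ℕ) : Matrix (Fin P × Fin P) (Fin P × Fin P) ℝ :=
  Matrix.of fun p q => if p.1 = q.2 ∧ p.2 = q.1 then 1 else 0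

theorem entry_eq {P : ℕ} (W : Fin P → Fin P → Fin P → ℝ) (l n m : Fin P) :
    (W2T W + swapMat P * W2T W) (l, n) m = W l m n + W n m l := by
  have h : (swapMat P * W2T W) (l, n) m = W n m l := by
    rw [Matrix.mul_apply, Finset.sum_eq_single (n, l)]
    · simp [swapMat, W2T]
    · rintro ⟨a, b⟩ - hab
      have : ¬ (l = b ∧ n = a) := by
        rintro ⟨rfl, rfl⟩
        exact hab rfl
      simp [swapMat, this]
    · simp
  rw [Matrix.add_apply, h]
  simp [W2T]

theorem score_eq {d P : ℕ} (W : Fin P → Fin P → Fin P → ℝ) (h r t : Fin d → Fin P → ℝ) :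
    score W h r t = ∑ k, ∑ l, ∑ n, h k l * t k n * ∑ m, W l m n * r k m := by
  unfold score
  simp only [Finset.mul_sum]
  rw [Finset.sum_comm]
  have h1 : ∀ m l : Fin P, (∑ n, ∑ k, W l m n * (h k l * r k m * t k n)) =
      ∑ k, ∑ n, h k l * t k n * (W l m n * r k m) := by
    intro m l
    rw [Finset.sum_comm]
    refine Finset.sum_congr rfl fun k _ => Finset.sum_congr rfl fun n _ => by ring
  simp only [h1]
  rw [Finset.sum_comm]
  have h2 : ∀ l : Fin P, (∑ m, ∑ k, ∑ n, h k l * t k n * (W l m n * r k m)) =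
      ∑ k, ∑ n, ∑ m, h k l * t k n * (W l m n * r k m) := by
    intro l
    rw [Finset.sum_comm]
    exact Finset.sum_congr rfl fun k _ => Finset.sum_comm
  simp only [h2]
  exact Finset.sum_comm

theorem score_add {d P : ℕ} (W : Fin P → Fin P → Fin P → ℝ) (h r t : Fin d → Fin P → ℝ) :
    score W h r t + score W t r h =
      ∑ k, ∑ l, ∑ n, h k l * t k n * ((W2T W + swapMat P * W2T W) *ᵥ r k) (l, n) := by
  have h3 : score W t r h = ∑ k, ∑ l, ∑ n, h k l * t k n * ∑ m, W n m l * r k m := by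
    rw [score_eq]
    refine Finset.sum_congr rfl fun k _ => ?_
    rw [Finset.sum_comm]
    refine Finset.sum_congr rfl fun l _ => Finset.sum_congr rfl fun n _ => by ring
  rw [h3, score_eq]
  simp only [← Finset.sum_add_distrib, ← mul_add]
  refine Finset.sum_congr rfl fun k _ => Finset.sum_congr rfl fun l _ =>
    Finset.sum_congr rfl fun n _ => ?_
  simp only [Matrix.mulVec, dotProduct, entry_eq, add_mul]

theorem rank_lt_iff {P : ℕ} {ι : Type*} [Fintype ι] (M : Matrix ι (Fin P) ℝ) :
    M.rank < P ↔ ∃ v : Fin P → ℝ, v ≠ 0 ∧ M *ᵥ v = 0 := by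
  have h := LinearMap.finrank_range_add_finrank_ker M.mulVecLin
  rw [Module.finrank_fin_fun] at h
  change M.rank + _ = _ at h
  have h2 : M.rank < P ↔ Module.finrank ℝ (LinearMap.ker M.mulVecLin) ≠ 0 := by omega
  rw [h2, Ne, Submodule.finrank_eq_zero, Submodule.eq_bot_iff]
  push Not
  constructor
  · rintro ⟨v, hv, h0⟩
    exact ⟨v, h0, by simpa using hv⟩
  · rintro ⟨v, h0, hv⟩
    exact ⟨v, by simpa using hv, h0⟩

/-- the model can learn antisymmetry rules iff
`rank(W_(2)ᵀ + S·W_(2)ᵀ) < P`. -/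
theorem stmt12 {d P : ℕ} (hd : 1 ≤ d) (hP : 1 ≤ P)
    (W : Fin P → Fin P → Fin P → ℝ) :
    (∃ r : Fin d → Fin P → ℝ, r ≠ 0 ∧
        ∀ h t : Fin d → Fin P → ℝ, score W h r t = - score W t r h) ↔
      (W2T W + swapMat P * W2T W).rank < P := by
  rw [rank_lt_iff]
  constructor
  · rintro ⟨r, hr, H⟩
    obtain ⟨k, hk⟩ := Function.ne_iff.mp hr
    refine ⟨r k, hk, ?_⟩
    ext ⟨l, n⟩
    have := score_add W (Pi.single k (Pi.single l 1)) r (Pi.single k (Pi.single n 1))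
    rw [H, neg_add_cancel, Finset.sum_eq_single k, Finset.sum_eq_single l,
      Finset.sum_eq_single n] at this
    · simpa using this.symm
    · intro b _ hb
      simp [hb]
    · simp
    · intro b _ hb
      simp [hb]
    · simp
    · intro b _ hb
      simp [hb]
    · simp
  · rintro ⟨v, hv, hM⟩
    refine ⟨fun _ => v, ?_, ?_⟩
    · intro h0
      exact hv (congrFun h0 ⟨0, hd⟩)
    · intro h t
      rw [eq_neg_iff_add_eq_zero, score_add]
      simp [hM]
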